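/- Let N be the normal closure in G_ρ of the set {g^v · g^w · (g^{v+w})⁻¹ : g ∈ G, v, w ∈ V}, let Q = G_ρ/N, and let Q^{ab} be the abelianization of Q. Then for every r ∈ R, the endomorphism φ_r of G_ρ determined by φ_r(g^v) = g^{r·v} maps N into N and hence induces an endomorphism φ̄_r of Q^{ab}; and for all r₁, r₂ ∈ R and all z ∈ Q^{ab} one has φ̄_{r₁+r₂}(z) = φ̄_{r₁}(z)·φ̄_{r₂}(z). Consequently Q^{ab}, written additively, is a left R-module under r·z = φ̄_r(z). -/

import Mathlib

/-- The defining relators of Crowell's derived group of the permutation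
representation associated to a right action `act` of `G` on `Γ`:
`(γ, g*h) * ((γ, g) * (γ·g, h))⁻¹` for `g, h ∈ G` and `γ ∈ Γ`. -/
def derivedRels {Γ : Type*} {G : Type*} [Group G] (act : Γ → G → Γ) :
    Set (FreeGroup (Γ × G)) :=
  {r | ∃ (γ : Γ) (g h : G),
    r = FreeGroup.of (γ, g * h) *
      (FreeGroup.of (γ, g) * FreeGroup.of (act γ g, h))⁻¹}

/-- Crowell's derived group `G_ρ`. -/
def DerivedGroup {Γ : Type*} {G : Type*} [Group G] (act : Γ → G → Γ) :=
  PresentedGroup (derivedRels act)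

instance {Γ : Type*} {G : Type*} [Group G] (act : Γ → G → Γ) :
    Group (DerivedGroup act) :=
  inferInstanceAs (Group (PresentedGroup (derivedRels act)))

/-- The generator `g^γ` of the derived group. -/
def derivedGen {Γ : Type*} {G : Type*} [Group G] (act : Γ → G → Γ)
    (γ : Γ) (g : G) : DerivedGroup act :=
  PresentedGroup.of (rels := derivedRels act) (γ, g)

/-- The additivity relators `g^v · g^w · (g^{v+w})⁻¹` in the derived group of an
action of `G` on a module `V`. -/
def addRels {V : Type*} [AddCommGroup V] {G : Type*} [Group G]
    (act : V → G → V) : Set (DerivedGroup act) :=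
  {z | ∃ (g : G) (v w : V),
    z = derivedGen act v g * derivedGen act w g * (derivedGen act (v + w) g)⁻¹}

/-- The quotient `Q` of the derived group by the normal closure of the
additivity relators. -/
def QGroup {V : Type*} [AddCommGroup V] {G : Type*} [Group G]
    (act : V → G → V) :=
  DerivedGroup act ⧸ Subgroup.normalClosure (addRels act)

instance {V : Type*} [AddCommGroup V] {G : Type*} [Group G]
    (act : V → G → V) : Group (QGroup act) :=
  inferInstanceAs (Group (DerivedGroup act ⧸ Subgroup.normalClosure (addRels act)))

/-- The canonical map from the derived group to the abelianization `Q^{ab}`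
of the quotient `Q`. -/
def toQab {V : Type*} [AddCommGroup V] {G : Type*} [Group G]
    (act : V → G → V) (u : DerivedGroup act) : Abelianization (QGroup act) :=
  Abelianization.of
    ((QuotientGroup.mk' (Subgroup.normalClosure (addRels act)) u : QGroup act))

theorem derivedGen_mul {Γ : Type*} {G : Type*} [Group G] (act : Γ → G → Γ)
    (γ : Γ) (g h : G) :
    derivedGen act γ (g * h) = derivedGen act γ g * derivedGen act (act γ g) h := by
  have h₁ : PresentedGroup.mk (derivedRels act) (FreeGroup.of (γ, g * h)) =
      PresentedGroup.mk (derivedRels act)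
        (FreeGroup.of (γ, g) * FreeGroup.of (act γ g, h)) :=
    PresentedGroup.mk_eq_mk_of_mul_inv_mem ⟨γ, g, h, rfl⟩
  rw [map_mul] at h₁
  exact h₁

theorem DerivedGroup.hom_ext {Γ : Type*} {G : Type*} [Group G] {act : Γ → G → Γ}
    {H : Type*} [Group H] {φ ψ : DerivedGroup act →* H}
    (h : ∀ γ g, φ (derivedGen act γ g) = ψ (derivedGen act γ g)) : φ = ψ :=
  PresentedGroup.ext (rels := derivedRels act) fun x => h x.1 x.2

/-- The endomorphism of the derived group induced by an equivariant self-map of `Γ`. -/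
def DerivedGroup.map {Γ : Type*} {G : Type*} [Group G] {act : Γ → G → Γ}
    (f : Γ → Γ) (hf : ∀ γ g, act (f γ) g = f (act γ g)) :
    DerivedGroup act →* DerivedGroup act :=
  PresentedGroup.toGroup (rels := derivedRels act)
    (f := fun x : Γ × G => derivedGen act (f x.1) x.2) <| by
      rintro _ ⟨γ, g, h, rfl⟩
      simp only [map_mul, map_inv, FreeGroup.lift_apply_of]
      rw [derivedGen_mul, hf, mul_inv_cancel]

theorem DerivedGroup.map_derivedGen {Γ : Type*} {G : Type*} [Group G] {act : Γ → G → Γ}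
    (f : Γ → Γ) (hf : ∀ γ g, act (f γ) g = f (act γ g)) (γ : Γ) (g : G) :
    DerivedGroup.map f hf (derivedGen act γ g) = derivedGen act (f γ) g :=
  PresentedGroup.toGroup.of _

/-- `toQab` as a group homomorphism. -/
def toQabHom {V : Type*} [AddCommGroup V] {G : Type*} [Group G] (act : V → G → V) :
    DerivedGroup act →* Abelianization (QGroup act) :=
  (Abelianization.of (G := QGroup act)).comp
    (QuotientGroup.mk' (Subgroup.normalClosure (addRels act)))

theorem toQabHom_surjective {V : Type*} [AddCommGroup V] {G : Type*} [Group G]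
    (act : V → G → V) : Function.Surjective (toQabHom act) :=
  (QuotientGroup.mk'_surjective (commutator (QGroup act))).comp
    (QuotientGroup.mk'_surjective (Subgroup.normalClosure (addRels act)))

theorem toQabHom_derivedGen_add {V : Type*} [AddCommGroup V] {G : Type*} [Group G]
    (act : V → G → V) (v w : V) (g : G) :
    toQabHom act (derivedGen act (v + w) g) =
      toQabHom act (derivedGen act v g) * toQabHom act (derivedGen act w g) := by
  have h : QuotientGroup.mk' (Subgroup.normalClosure (addRels act))
      (derivedGen act v g * derivedGen act w g * (derivedGen act (v + w) g)⁻¹) = 1 :=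
    (QuotientGroup.eq_one_iff _).2 (Subgroup.subset_normalClosure ⟨g, v, w, rfl⟩)
  have h₁ : toQabHom act
      (derivedGen act v g * derivedGen act w g * (derivedGen act (v + w) g)⁻¹) = 1 :=
    (congrArg (Abelianization.of (G := QGroup act)) h).trans (map_one _)
  rw [map_mul, map_inv, mul_inv_eq_one, map_mul] at h₁
  exact h₁.symm

theorem Qab.hom_ext {V : Type*} [AddCommGroup V] {G : Type*} [Group G] {act : V → G → V}
    {H : Type*} [Group H] {φ ψ : Abelianization (QGroup act) →* H}
    (h : ∀ v g, φ (toQabHom act (derivedGen act v g)) =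
      ψ (toQabHom act (derivedGen act v g))) : φ = ψ :=
  (MonoidHom.cancel_right (toQabHom_surjective act)).1 (DerivedGroup.hom_ext h)

theorem normalClosure_addRels_le_comap {V : Type*} [AddCommGroup V] {G : Type*} [Group G]
    {act : V → G → V} (f : V →+ V) (φ : DerivedGroup act →* DerivedGroup act)
    (hφ : ∀ g v, φ (derivedGen act v g) = derivedGen act (f v) g) :
    Subgroup.normalClosure (addRels act) ≤
      (Subgroup.normalClosure (addRels act)).comap φ := by
  refine Subgroup.normalClosure_le_normal ?_
  rintro _ ⟨g, v, w, rfl⟩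
  refine Subgroup.subset_normalClosure ⟨g, f v, f w, ?_⟩
  simp only [map_mul, map_inv, hφ, map_add]

theorem exists_qabEnd {V : Type*} [AddCommGroup V] {G : Type*} [Group G]
    {act : V → G → V} (f : V →+ V) (φ : DerivedGroup act →* DerivedGroup act)
    (hφ : ∀ g v, φ (derivedGen act v g) = derivedGen act (f v) g) :
    ∃ ψ : Abelianization (QGroup act) →* Abelianization (QGroup act),
      ∀ u, ψ (toQabHom act u) = toQabHom act (φ u) :=
  ⟨Abelianization.map (G := QGroup act) (H := QGroup act)
    (QuotientGroup.map _ _ φ (normalClosure_addRels_le_comap f φ hφ)), fun _ => rfl⟩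

/-- The coordinate action of `R` descends to the abelianization of `Q`, acts
additively there, and makes `Q^{ab}` a left `R`-module. -/
theorem derived_module_structure {R : Type*} [Ring R] {V : Type*} [AddCommGroup V]
    [Module R V] {G : Type*} [Group G]
    (act : V → G → V)
    (act_one : ∀ v : V, act v 1 = v)
    (act_mul : ∀ (v : V) (g h : G), act v (g * h) = act (act v g) h)
    (act_add : ∀ (v w : V) (g : G), act (v + w) g = act v g + act w g)
    (act_smul : ∀ (r : R) (v : V) (g : G), act (r • v) g = r • act v g) :
    -- `φ_r` maps `N` into `N`
    (∀ (r : R) (φr : DerivedGroup act →* DerivedGroup act),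
      (∀ (g : G) (v : V), φr (derivedGen act v g) = derivedGen act (r • v) g) →
      ∀ z ∈ Subgroup.normalClosure (addRels act),
        φr z ∈ Subgroup.normalClosure (addRels act)) ∧
    -- hence `φ_r` induces an endomorphism `ψ` of `Q^{ab}`
    (∀ (r : R) (φr : DerivedGroup act →* DerivedGroup act),
      (∀ (g : G) (v : V), φr (derivedGen act v g) = derivedGen act (r • v) g) →
      ∃ ψ : Abelianization (QGroup act) →* Abelianization (QGroup act),
        ∀ u : DerivedGroup act, ψ (toQab act u) = toQab act (φr u)) ∧
    -- the induced endomorphisms are additive in `r`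
    (∀ (r₁ r₂ : R) (φ₁ φ₂ φ₁₂ : DerivedGroup act →* DerivedGroup act)
      (ψ₁ ψ₂ ψ₁₂ : Abelianization (QGroup act) →* Abelianization (QGroup act)),
      (∀ (g : G) (v : V), φ₁ (derivedGen act v g) = derivedGen act (r₁ • v) g) →
      (∀ (g : G) (v : V), φ₂ (derivedGen act v g) = derivedGen act (r₂ • v) g) →
      (∀ (g : G) (v : V), φ₁₂ (derivedGen act v g) = derivedGen act ((r₁ + r₂) • v) g) →
      (∀ u : DerivedGroup act, ψ₁ (toQab act u) = toQab act (φ₁ u)) →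
      (∀ u : DerivedGroup act, ψ₂ (toQab act u) = toQab act (φ₂ u)) →
      (∀ u : DerivedGroup act, ψ₁₂ (toQab act u) = toQab act (φ₁₂ u)) →
      ∀ z : Abelianization (QGroup act), ψ₁₂ z = ψ₁ z * ψ₂ z) ∧
    -- consequently `Q^{ab}` (written additively) is a left `R`-module
    (∃ _ : Module R (Additive (Abelianization (QGroup act))),
      ∀ (r : R) (φr : DerivedGroup act →* DerivedGroup act),
        (∀ (g : G) (v : V), φr (derivedGen act v g) = derivedGen act (r • v) g) →
        ∀ u : DerivedGroup act,
          r • Additive.ofMul (toQab act u) = Additive.ofMul (toQab act (φr u))) := by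
  have ext_add : ∀ (r₁ r₂ : R)
      (ψ₁ ψ₂ ψ₁₂ : Abelianization (QGroup act) →* Abelianization (QGroup act)),
      (∀ v g, ψ₁ (toQabHom act (derivedGen act v g)) =
        toQabHom act (derivedGen act (r₁ • v) g)) →
      (∀ v g, ψ₂ (toQabHom act (derivedGen act v g)) =
        toQabHom act (derivedGen act (r₂ • v) g)) →
      (∀ v g, ψ₁₂ (toQabHom act (derivedGen act v g)) =
        toQabHom act (derivedGen act ((r₁ + r₂) • v) g)) →
      ψ₁₂ = ψ₁ * ψ₂ := by
    intro r₁ r₂ ψ₁ ψ₂ ψ₁₂ h₁ h₂ h₁₂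
    refine Qab.hom_ext fun v g => ?_
    rw [MonoidHom.mul_apply, h₁, h₂, h₁₂, add_smul, toQabHom_derivedGen_add]
  refine ⟨fun r φ hφ z hz =>
      normalClosure_addRels_le_comap (DistribSMul.toAddMonoidHom V r) φ hφ hz,
    fun r φ hφ => exists_qabEnd (DistribSMul.toAddMonoidHom V r) φ hφ, ?_, ?_⟩
  · intro r₁ r₂ φ₁ φ₂ φ₁₂ ψ₁ ψ₂ ψ₁₂ h₁ h₂ h₁₂ k₁ k₂ k₁₂ z
    have key := ext_add r₁ r₂ ψ₁ ψ₂ ψ₁₂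
      (fun v g => (k₁ _).trans (congrArg (toQab act) (h₁ g v)))
      (fun v g => (k₂ _).trans (congrArg (toQab act) (h₂ g v)))
      (fun v g => (k₁₂ _).trans (congrArg (toQab act) (h₁₂ g v)))
    rw [key, MonoidHom.mul_apply]
  · have exists_end : ∀ r : R,
        ∃ ψ : Abelianization (QGroup act) →* Abelianization (QGroup act),
          ∀ v g, ψ (toQabHom act (derivedGen act v g)) =
            toQabHom act (derivedGen act (r • v) g) := by
      intro r
      have hr := DerivedGroup.map_derivedGen (act := act) (r • ·) (act_smul r)
      obtain ⟨ψ, hψ⟩ := exists_qabEnd (DistribSMul.toAddMonoidHom V r) _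
        (fun g v => hr v g)
      exact ⟨ψ, fun v g => by rw [hψ, hr]⟩
    choose Ψ hΨ using exists_end
    have Ψ_one : Ψ 1 = MonoidHom.id _ :=
      Qab.hom_ext fun v g => by rw [hΨ, one_smul, MonoidHom.id_apply]
    have Ψ_mul : ∀ r s, Ψ (r * s) = (Ψ r).comp (Ψ s) := fun r s =>
      Qab.hom_ext fun v g => by rw [MonoidHom.comp_apply, hΨ, hΨ, hΨ, mul_smul]
    have Ψ_add : ∀ r s, Ψ (r + s) = Ψ r * Ψ s := fun r s =>
      ext_add r s _ _ _ (hΨ r) (hΨ s) (hΨ (r + s))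
    let Φ : R →+* AddMonoid.End (Additive (Abelianization (QGroup act))) :=
      RingHom.mk'
        { toFun := fun r => MonoidHom.toAdditive (Ψ r)
          map_one' := by rw [Ψ_one]; rfl
          map_mul' := fun r s => by rw [Ψ_mul]; rfl }
        (fun r s => congrArg MonoidHom.toAdditive (Ψ_add r s))
    refine ⟨Module.compHom _ Φ, fun r φ hφ u => ?_⟩
    have h : (Ψ r).comp (toQabHom act) = (toQabHom act).comp φ :=
      DerivedGroup.hom_ext fun v g => by
        rw [MonoidHom.comp_apply, MonoidHom.comp_apply, hΨ, hφ]
    exact congrArg Additive.ofMul (DFunLike.congr_fun h u)
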